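/- Let P be a polynomial with complex coefficients of degree n having no zeros in the open unit disk {z : |z| < 1}, let a be a complex number with |a| ≤ 1, and let β be a complex number with |β| ≤ 1. Then for every complex z with |z| ≥ 1, |z·((1+az)P″(z) − (n−1)a·P′(z)) + (n/2)·β·((1+az)P′(z) − n·a·P(z)) + P′(z)| ≤ (n/2)·[ |1 + β/2| · n|z|^(n−1) + (n/2)·|β|·|a| ] · max_{|w|=1} |P(w)|. -/

import Mathlib

open Polynomial

/-- The modified Smirnov operator: S̃ₐ[P](z) = (1+az)·P′(z) − n·a·P(z). -/
noncomputable def smirnov (n : ℕ) (a : ℂ) (P : Polynomial ℂ) (z : ℂ) : ℂ :=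
  (1 + a * z) * P.derivative.eval z - (n : ℂ) * a * P.eval z

/-- The maximum of ‖P‖ on the unit circle. -/
noncomputable def maxCircle (P : Polynomial ℂ) : ℝ :=
  sSup {y : ℝ | ∃ w : ℂ, ‖w‖ = 1 ∧ y = ‖P.eval w‖}

open ComplexConjugate

namespace Polynomial

/-- The conjugate reciprocal `z ↦ zⁿ · conj (P (1 / conj z))` of `P`, relative to degree `n`. -/
noncomputable def conjReflect (n : ℕ) (P : ℂ[X]) : ℂ[X] :=
  reflect n (P.map (starRingEnd ℂ))

lemma coeff_conjReflect (n : ℕ) (P : ℂ[X]) {k : ℕ} (hk : k ≤ n) :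
    (conjReflect n P).coeff k = conj (P.coeff (n - k)) := by
  rw [conjReflect, coeff_reflect, revAt_le hk, coeff_map]

lemma natDegree_conjReflect_le (n : ℕ) {P : ℂ[X]} (hP : P.natDegree ≤ n) :
    (conjReflect n P).natDegree ≤ n := by
  rw [natDegree_le_iff_coeff_eq_zero]
  intro k hk
  rw [conjReflect, coeff_reflect, revAt_eq_self_of_lt hk, coeff_map,
    coeff_eq_zero_of_natDegree_lt (hP.trans_lt hk), map_zero]

lemma conjReflect_sub_C (n : ℕ) (P : ℂ[X]) (c : ℂ) :
    conjReflect n (P - C c) = conjReflect n P - C (conj c) * X ^ n := by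
  simp [conjReflect, Polynomial.map_sub, reflect_sub, reflect_C]

lemma eval_conjReflect {n : ℕ} {P : ℂ[X]} (hP : P.natDegree ≤ n) {z : ℂ} (hz : z ≠ 0) :
    (conjReflect n P).eval z = z ^ n * conj (P.eval (conj z)⁻¹) := by
  let _ : Invertible z⁻¹ := invertibleOfNonzero (inv_ne_zero hz)
  have h := eval₂_reflect_mul_pow (RingHom.id ℂ) z⁻¹ n (P.map (starRingEnd ℂ))
    (natDegree_map_le.trans hP)
  rw [invOf_eq_inv, inv_inv, eval₂_id, eval₂_id] at h
  have h' : (P.map (starRingEnd ℂ)).eval z⁻¹ = conj (P.eval (conj z)⁻¹) := by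
    have := eval_map_apply (f := starRingEnd ℂ) (p := P) (conj z)⁻¹
    rwa [map_inv₀, Complex.conj_conj] at this
  rw [conjReflect, ← h', ← h, mul_comm, mul_assoc, ← mul_pow, inv_mul_cancel₀ hz, one_pow, mul_one]

lemma norm_eval_conjReflect {n : ℕ} {P : ℂ[X]} (hP : P.natDegree ≤ n) {z : ℂ} (hz : z ≠ 0) :
    ‖(conjReflect n P).eval z‖ = ‖z‖ ^ n * ‖P.eval (conj z)⁻¹‖ := by
  rw [eval_conjReflect hP hz, norm_mul, norm_pow, RCLike.norm_conj]

lemma norm_eval_eq_prod_roots (P : ℂ[X]) (z : ℂ) :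
    ‖P.eval z‖ = ‖P.leadingCoeff‖ * (P.roots.map fun r => ‖z - r‖).prod := by
  rw [(IsAlgClosed.splits P).eval_eq_prod_roots, norm_mul]
  congr 1
  have := Multiset.prod_hom (P.roots.map (z - ·)) (normHom (α := ℂ))
  rw [Multiset.map_map] at this
  exact this.symm

/-- Maximum modulus principle for polynomials on the unit disk. -/
lemma norm_eval_le_of_forall_norm_eq_one {P : ℂ[X]} {M : ℝ}
    (hM : ∀ w : ℂ, ‖w‖ = 1 → ‖P.eval w‖ ≤ M) {z : ℂ} (hz : ‖z‖ ≤ 1) : ‖P.eval z‖ ≤ M := by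
  refine Complex.norm_le_of_forall_mem_frontier_norm_le (U := Metric.ball 0 1)
    (f := fun w => P.eval w) Metric.isBounded_ball P.differentiable.diffContOnCl ?_ ?_
  · intro w hw
    rw [frontier_ball _ one_ne_zero] at hw
    exact hM w (by simpa using hw)
  · rw [closure_ball _ one_ne_zero]
    simpa using hz

lemma norm_eval_conjReflect_of_norm_eq_one {n : ℕ} {P : ℂ[X]} (hP : P.natDegree ≤ n) {w : ℂ}
    (hw : ‖w‖ = 1) : ‖(conjReflect n P).eval w‖ = ‖P.eval w‖ := by
  have hw0 : w ≠ 0 := norm_ne_zero_iff.mp (by simp [hw])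
  rw [norm_eval_conjReflect hP hw0, hw, one_pow, one_mul, ← map_inv₀, Complex.inv_def,
    Complex.normSq_eq_norm_sq, hw]
  simp

/-- A polynomial bounded by `M` on the unit circle has its leading coefficient bounded by `M`,
and its growth outside the unit disk is controlled by that of `M zⁿ`. -/
lemma norm_eval_le_mul_pow {n : ℕ} {P : ℂ[X]} (hP : P.natDegree ≤ n) {M : ℝ}
    (hM : ∀ w : ℂ, ‖w‖ = 1 → ‖P.eval w‖ ≤ M) :
    ‖P.coeff n‖ ≤ M ∧ ∀ z : ℂ, 1 < ‖z‖ → ‖P.eval z‖ ≤ M * ‖z‖ ^ n := by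
  have hQ : ∀ w : ℂ, ‖w‖ ≤ 1 → ‖(conjReflect n P).eval w‖ ≤ M := fun w hw =>
    norm_eval_le_of_forall_norm_eq_one
      (fun v hv => (norm_eval_conjReflect_of_norm_eq_one hP hv).le.trans (hM v hv)) hw
  constructor
  · have := hQ 0 (by simp)
    rwa [← coeff_zero_eq_eval_zero, coeff_conjReflect n P n.zero_le, tsub_zero,
      RCLike.norm_conj] at this
  · intro z hz
    have hz0 : z ≠ 0 := norm_pos_iff.mp (by linarith)
    have hw := hQ (conj z)⁻¹ (by
      rw [norm_inv, RCLike.norm_conj]; exact inv_le_one_of_one_le₀ hz.le)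
    rw [norm_eval_conjReflect hP (by simpa using hz0)] at hw
    simp only [map_inv₀, Complex.conj_conj, inv_inv, norm_inv, RCLike.norm_conj, inv_pow] at hw
    rwa [inv_mul_le_iff₀ (by positivity), mul_comm] at hw

/-- A polynomial without zeros in the open unit disk is dominated, outside the unit disk, by its
conjugate reciprocal. -/
lemma norm_eval_le_norm_eval_conjReflect {n : ℕ} {P : ℂ[X]} (hP : P.natDegree = n)
    (hP0 : ∀ w : ℂ, ‖w‖ < 1 → P.eval w ≠ 0) {z : ℂ} (hz : 1 < ‖z‖) :
    ‖P.eval z‖ ≤ ‖(conjReflect n P).eval z‖ := by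
  have hz0 : z ≠ 0 := norm_pos_iff.mp (by linarith)
  have hcard : P.roots.card = n := by
    rw [← hP]; exact splits_iff_card_roots.mp (IsAlgClosed.splits P)
  have hpow : ‖z‖ ^ n = (P.roots.map fun _ => ‖z‖).prod := by
    rw [Multiset.map_const', Multiset.prod_replicate, hcard]
  rw [norm_eval_conjReflect hP.le hz0, norm_eval_eq_prod_roots, norm_eval_eq_prod_roots P,
    mul_left_comm, hpow, ← Multiset.prod_map_mul]
  gcongr
  refine Multiset.prod_map_le_prod_map₀ _ _ (fun _ _ => norm_nonneg _) fun r hr => ?_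
  have hr1 : 1 ≤ ‖r‖ := by
    by_contra! h
    exact hP0 r h (isRoot_of_mem_roots hr)
  have h1 : ‖z‖ * ‖(conj z)⁻¹ - r‖ = ‖1 - conj z * r‖ := by
    rw [← RCLike.norm_conj z, ← norm_mul, mul_sub, mul_inv_cancel₀ (by simpa using hz0)]
  rw [h1]
  refine le_of_pow_le_pow_left₀ two_ne_zero (norm_nonneg _) ?_
  have h2 := mul_nonneg (sub_nonneg.mpr (one_le_pow₀ (n := 2) hz.le))
    (sub_nonneg.mpr (one_le_pow₀ (n := 2) hr1))
  rw [Complex.sq_norm, Complex.sq_norm, Complex.normSq_apply, Complex.normSq_apply] at h2 ⊢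
  simp only [Complex.sub_re, Complex.sub_im, Complex.mul_re, Complex.mul_im, Complex.conj_re,
    Complex.conj_im, Complex.one_re, Complex.one_im]
  nlinarith [h2]

lemma norm_leadingCoeff_le_norm_eval_zero {P : ℂ[X]}
    (hP0 : ∀ w : ℂ, ‖w‖ < 1 → P.eval w ≠ 0) : ‖P.leadingCoeff‖ ≤ ‖P.eval 0‖ := by
  rw [norm_eval_eq_prod_roots P 0]
  refine le_mul_of_one_le_right (norm_nonneg _) (Multiset.one_le_prod_map fun r hr => ?_)
  rw [zero_sub, norm_neg]
  by_contra! h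
  exact hP0 r h (isRoot_of_mem_roots hr)

/-- A quantitative form of Laguerre's theorem for polynomials with all zeros in the closed unit
disk. -/
lemma natDegree_mul_eval_add_mul_eval_derivative_ne_zero {n : ℕ} (hn : n ≠ 0) {F : ℂ[X]}
    (hF : F.natDegree = n) (hF0 : ∀ w : ℂ, 1 < ‖w‖ → F.eval w ≠ 0) {A B z : ℂ} (hz : 1 < ‖z‖)
    (hAB : ‖B‖ < ‖A * (‖z‖ ^ 2 - 1) + B * conj z‖) :
    n * A * F.eval z + B * F.derivative.eval z ≠ 0 := by
  have hcard : F.roots.card = n := by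
    rw [← hF]; exact splits_iff_card_roots.mp (IsAlgClosed.splits F)
  rw [(IsAlgClosed.splits F).eval_derivative_eq_eval_mul_sum (hF0 z hz)]
  set G := (F.roots.map fun r => 1 / (z - r)).sum with hG
  have key : ‖G * (‖z‖ ^ 2 - 1) - n * conj z‖ ≤ n := by
    have h1 : G * (‖z‖ ^ 2 - 1) - n * conj z =
        (F.roots.map fun r => 1 / (z - r) * (‖z‖ ^ 2 - 1) - conj z).sum := by
      rw [Multiset.sum_map_sub, Multiset.sum_map_mul_right, Multiset.map_const',
        Multiset.sum_replicate, hcard, nsmul_eq_mul]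
    rw [h1]
    refine (norm_multiset_sum_le _).trans ?_
    rw [Multiset.map_map]
    refine (Multiset.sum_le_card_nsmul _ 1 ?_).trans (by simp [hcard])
    intro x hx
    obtain ⟨r, hr, rfl⟩ := Multiset.mem_map.mp hx
    have hr1 : ‖r‖ ≤ 1 := by
      by_contra! h
      exact hF0 r h (isRoot_of_mem_roots hr)
    have hzr : z - r ≠ 0 := fun h => by
      rw [sub_eq_zero] at h; rw [h] at hz; linarith
    have h2 : 1 / (z - r) * (‖z‖ ^ 2 - 1) - conj z = (conj z * r - 1) / (z - r) := by
      rw [← Complex.mul_conj']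
      field_simp
      ring
    rw [Function.comp_apply, h2, norm_div, div_le_one (norm_pos_iff.mpr hzr)]
    refine le_of_pow_le_pow_left₀ two_ne_zero (norm_nonneg _) ?_
    have h3 := mul_nonneg (sub_nonneg.mpr (one_le_pow₀ (n := 2) hz.le))
      (sub_nonneg.mpr (pow_le_one₀ (n := 2) (norm_nonneg r) hr1))
    rw [Complex.sq_norm, Complex.sq_norm, Complex.normSq_apply, Complex.normSq_apply] at h3 ⊢
    simp only [Complex.sub_re, Complex.sub_im, Complex.mul_re, Complex.mul_im, Complex.conj_re,
      Complex.conj_im, Complex.one_re, Complex.one_im]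
    nlinarith [h3]
  intro h0
  have h1 : n * A + B * G = 0 := by
    refine (mul_eq_zero.mp ?_).resolve_left (hF0 z hz)
    linear_combination h0
  have h2 : n * (A * (‖z‖ ^ 2 - 1) + B * conj z) = -(B * (G * (‖z‖ ^ 2 - 1) - n * conj z)) := by
    linear_combination (‖z‖ ^ 2 - 1 : ℂ) * h1
  have h3 := congrArg norm h2
  rw [norm_neg, norm_mul, norm_mul, Complex.norm_natCast] at h3
  have hn' : (0 : ℝ) < n := by positivity
  nlinarith [norm_nonneg B]

section Functional

variable {n : ℕ} {T : ℂ[X] →ₗ[ℂ] ℂ}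

/-- Bernstein-type comparison with `M zⁿ` for functionals that do not vanish on polynomials of
degree `n` with all zeros in the closed unit disk. -/
lemma norm_functional_le_mul
    (hT : ∀ F : ℂ[X], F.natDegree = n → (∀ w : ℂ, 1 < ‖w‖ → F.eval w ≠ 0) → T F ≠ 0)
    {P : ℂ[X]} (hP : P.natDegree ≤ n) {M : ℝ} (hM : ∀ w : ℂ, ‖w‖ = 1 → ‖P.eval w‖ ≤ M) :
    ‖T P‖ ≤ M * ‖T (X ^ n)‖ := by
  obtain ⟨hcoeff, hgrowth⟩ := norm_eval_le_mul_pow hP hM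
  have hX : T (X ^ n) ≠ 0 := hT _ (natDegree_X_pow n) fun w hw => by
    rw [eval_pow, eval_X]
    exact pow_ne_zero _ (norm_pos_iff.mp (by linarith))
  by_contra! h
  set μ := T P / T (X ^ n) with hμ
  have hμM : M < ‖μ‖ := by
    rwa [hμ, norm_div, lt_div_iff₀ (norm_pos_iff.mpr hX)]
  refine hT (P - C μ * X ^ n) ?_ ?_ ?_
  · refine natDegree_eq_of_le_of_coeff_ne_zero
      ((natDegree_sub_le_of_le hP (natDegree_C_mul_X_pow_le _ _)).trans (by simp)) ?_
    rw [coeff_sub, coeff_C_mul_X_pow, if_pos rfl, sub_ne_zero]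
    intro h'
    rw [h'] at hcoeff
    linarith
  · intro w hw h'
    rw [eval_sub, eval_C_mul, eval_pow, eval_X, sub_eq_zero] at h'
    have h1 := hgrowth w hw
    rw [h', norm_mul, norm_pow] at h1
    exact absurd (le_of_mul_le_mul_right h1 (by positivity)) hμM.not_ge
  · rw [map_sub, C_mul', map_smul, smul_eq_mul, hμ, div_mul_cancel₀ _ hX, sub_self]

lemma norm_functional_le_conjReflect
    (hT : ∀ F : ℂ[X], F.natDegree = n → (∀ w : ℂ, 1 < ‖w‖ → F.eval w ≠ 0) → T F ≠ 0)
    {P : ℂ[X]} (hP : P.natDegree = n) (hP0 : ∀ w : ℂ, ‖w‖ < 1 → P.eval w ≠ 0) :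
    ‖T P‖ ≤ ‖T (conjReflect n P)‖ := by
  by_contra! h
  have hTP : T P ≠ 0 := norm_pos_iff.mp ((norm_nonneg _).trans_lt h)
  set μ := T (conjReflect n P) / T P with hμ
  have hμ1 : ‖μ‖ < 1 := by
    rwa [hμ, norm_div, div_lt_one (norm_pos_iff.mpr hTP)]
  have not_eq : ∀ x y : ℂ, x ≠ 0 → ‖x‖ ≤ ‖y‖ → y - μ * x ≠ 0 := by
    intro x y hx hxy h'
    rw [sub_eq_zero] at h'
    rw [h', norm_mul] at hxy
    nlinarith [norm_pos_iff.mpr hx]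
  refine hT (conjReflect n P - C μ * P) ?_ ?_ ?_
  · refine natDegree_eq_of_le_of_coeff_ne_zero ((natDegree_sub_le_of_le
      (natDegree_conjReflect_le n hP.le) ((natDegree_C_mul_le _ _).trans hP.le)).trans (by simp)) ?_
    rw [coeff_sub, coeff_C_mul, coeff_conjReflect n P le_rfl, tsub_self]
    refine not_eq _ _ ?_ ?_
    · rw [← hP, coeff_natDegree, leadingCoeff_ne_zero]
      rintro rfl
      exact hP0 0 (by simp) eval_zero
    · rw [RCLike.norm_conj, coeff_zero_eq_eval_zero, ← hP]
      exact norm_leadingCoeff_le_norm_eval_zero hP0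
  · intro w hw
    rw [eval_sub, eval_C_mul]
    by_cases hPw : P.eval w = 0
    · have hw0 : w ≠ 0 := norm_pos_iff.mp (by linarith)
      rw [hPw, mul_zero, sub_zero, eval_conjReflect hP.le hw0]
      refine mul_ne_zero (pow_ne_zero _ hw0) ((_root_.map_ne_zero _).mpr (hP0 _ ?_))
      rw [norm_inv, RCLike.norm_conj]
      exact inv_lt_one_of_one_lt₀ hw
    · exact not_eq _ _ hPw (norm_eval_le_norm_eval_conjReflect hP hP0 hw)
  · rw [map_sub, C_mul', map_smul, smul_eq_mul, hμ, div_mul_cancel₀ _ hTP, sub_self]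

/-- Erdős–Lax-type inequality for functionals that do not vanish on polynomials of degree `n` with
all zeros in the closed unit disk. -/
lemma two_mul_norm_functional_le
    (hT : ∀ F : ℂ[X], F.natDegree = n → (∀ w : ℂ, 1 < ‖w‖ → F.eval w ≠ 0) → T F ≠ 0)
    {P : ℂ[X]} (hP : P.natDegree = n) (hP0 : ∀ w : ℂ, ‖w‖ < 1 → P.eval w ≠ 0)
    {M : ℝ} (hM : ∀ w : ℂ, ‖w‖ = 1 → ‖P.eval w‖ ≤ M) :
    2 * ‖T P‖ ≤ (‖T (X ^ n)‖ + ‖T 1‖) * M := by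
  have hM0 : 0 ≤ M := (norm_nonneg _).trans (hM 1 (by simp))
  have hPQ := norm_functional_le_conjReflect hT hP hP0
  set Q := conjReflect n P with hQ
  have hQM : ‖T Q‖ ≤ M * ‖T (X ^ n)‖ :=
    norm_functional_le_mul hT (natDegree_conjReflect_le n hP.le) fun w hw =>
      (norm_eval_conjReflect_of_norm_eq_one hP.le hw).le.trans (hM w hw)
  have key : ∀ K > M, 2 * ‖T P‖ ≤ (‖T (X ^ n)‖ + ‖T 1‖) * K := by
    intro K hK
    have hK0 : 0 < K := hM0.trans_lt hK
    obtain ⟨v, hv, hval⟩ : ∃ v : ℂ, ‖v‖ = 1 ∧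
        ‖T Q - K * v * T (X ^ n)‖ = K * ‖T (X ^ n)‖ - ‖T Q‖ := by
      refine ⟨Complex.exp (((T Q).arg - (T (X ^ n)).arg : ℝ) * Complex.I),
        Complex.norm_exp_ofReal_mul_I _, ?_⟩
      have h1 : T Q - K * Complex.exp (((T Q).arg - (T (X ^ n)).arg : ℝ) * Complex.I) * T (X ^ n)
          = ((‖T Q‖ - K * ‖T (X ^ n)‖ : ℝ) : ℂ) * Complex.exp ((T Q).arg * Complex.I) := by
        have h2 := Complex.norm_mul_exp_arg_mul_I (T Q)
        have h3 := Complex.norm_mul_exp_arg_mul_I (T (X ^ n))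
        have h4 : Complex.exp (((T Q).arg - (T (X ^ n)).arg : ℝ) * Complex.I) *
            Complex.exp ((T (X ^ n)).arg * Complex.I) = Complex.exp ((T Q).arg * Complex.I) := by
          rw [← Complex.exp_add]
          push_cast
          ring_nf
        rw [Complex.ofReal_sub ‖T Q‖, Complex.ofReal_mul]
        linear_combination (-1 : ℂ) * h2 - K * ‖T (X ^ n)‖ * h4 +
          K * Complex.exp (((T Q).arg - (T (X ^ n)).arg : ℝ) * Complex.I) * h3
      rw [h1, norm_mul, Complex.norm_exp_ofReal_mul_I, mul_one, Complex.norm_real,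
        Real.norm_of_nonpos] <;> nlinarith [norm_nonneg (T (X ^ n))]
    have hR := norm_functional_le_conjReflect hT (P := P - C (K * conj v))
      (by rw [natDegree_sub_C, hP]) (by
        intro w hw h'
        rw [eval_sub, eval_C, sub_eq_zero] at h'
        have := norm_eval_le_of_forall_norm_eq_one hM hw.le
        rw [h', norm_mul, RCLike.norm_conj, hv, mul_one, Complex.norm_real,
          Real.norm_of_nonneg hK0.le] at this
        linarith)
    rw [conjReflect_sub_C, map_sub, map_sub, C_mul', map_smul, ← mul_one (C _), C_mul', map_smul,
      smul_eq_mul, smul_eq_mul, map_mul, Complex.conj_conj, Complex.conj_ofReal, ← hQ, hval] at hR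
    have h2 := norm_sub_norm_le (T P) (K * conj v * T 1)
    rw [norm_mul, norm_mul, RCLike.norm_conj, hv, mul_one, Complex.norm_real,
      Real.norm_of_nonneg hK0.le] at h2
    linarith
  refine ge_of_tendsto (x := nhdsWithin M (Set.Ioi M)) (f := fun K => (‖T (X ^ n)‖ + ‖T 1‖) * K)
    ((Continuous.tendsto (by fun_prop) M).mono_left nhdsWithin_le_nhds) ?_
  filter_upwards [self_mem_nhdsWithin] with K hK using key K hK

end Functional

end Polynomial

lemma norm_eval_le_maxCircle (P : ℂ[X]) {w : ℂ} (hw : ‖w‖ = 1) : ‖P.eval w‖ ≤ maxCircle P := by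
  refine le_csSup ?_ ⟨w, hw, rfl⟩
  obtain ⟨b, hb⟩ := (isCompact_sphere (0 : ℂ) 1).bddAbove_image
    (f := fun w => ‖P.eval w‖) (by fun_prop)
  refine ⟨b, ?_⟩
  rintro y ⟨v, hv, rfl⟩
  exact hb ⟨v, by simpa using hv, rfl⟩

/-- The functional `P ↦ S̃ₐ[z P′ + (nβ/2) P](z)`. -/
noncomputable def smirnovFunctional (n : ℕ) (a β z : ℂ) : ℂ[X] →ₗ[ℂ] ℂ :=
  ((n * -a) • leval z + (1 + a * z) • leval z ∘ₗ derivative) ∘ₗ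
    ((n * (β / 2)) • LinearMap.id + LinearMap.mulLeft ℂ X ∘ₗ derivative)

lemma smirnovFunctional_apply (n : ℕ) (a β z : ℂ) (P : ℂ[X]) :
    smirnovFunctional n a β z P =
      n * -a * (n * (β / 2) * P.eval z + z * P.derivative.eval z) + (1 + a * z) *
        (n * (β / 2) * P.derivative.eval z + P.derivative.eval z
          + z * P.derivative.derivative.eval z) := by
  simp [smirnovFunctional, leval, derivative_mul, add_assoc]

lemma smirnovFunctional_X_pow {n : ℕ} (hn : n ≠ 0) (a β z : ℂ) :
    smirnovFunctional n a β z (X ^ n) = n ^ 2 * (1 + β / 2) * z ^ (n - 1) := by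
  obtain ⟨m, rfl⟩ := Nat.exists_eq_succ_of_ne_zero hn
  rw [smirnovFunctional_apply]
  rcases m with _ | m
  · simp; ring
  · simp
    ring

lemma smirnovFunctional_one (n : ℕ) (a β z : ℂ) :
    smirnovFunctional n a β z 1 = -(n ^ 2 * a * β / 2) := by
  rw [smirnovFunctional_apply]
  simp
  ring

lemma smirnovFunctional_ne_zero {n : ℕ} (hn : n ≠ 0) {a β z : ℂ} (ha : ‖a‖ < 1) (hβ : ‖β‖ ≤ 1)
    (hz : 1 < ‖z‖) (F : ℂ[X]) (hF : F.natDegree = n) (hF0 : ∀ w : ℂ, 1 < ‖w‖ → F.eval w ≠ 0) :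
    smirnovFunctional n a β z F ≠ 0 := by
  set B : ℂ[X] := C (n * (β / 2)) * F + X * derivative F with hB
  have hBeval : ∀ w, B.eval w = n * (β / 2) * F.eval w + w * F.derivative.eval w := by
    intro w; simp [hB]
  have hβ2 : ‖β / 2‖ ≤ 1 / 2 := by
    rw [norm_div, Complex.norm_ofNat]; linarith
  have hBdeg : B.natDegree = n := by
    refine natDegree_eq_of_le_of_coeff_ne_zero ?_ ?_
    · refine (natDegree_add_le_of_le ((natDegree_C_mul_le _ _).trans hF.le)
        (natDegree_mul_le.trans (add_le_add natDegree_X_le (natDegree_derivative_le F)))).trans ?_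
      rw [hF]
      omega
    · obtain ⟨m, rfl⟩ := Nat.exists_eq_succ_of_ne_zero hn
      have hlead : F.coeff (m + 1) ≠ 0 := by
        have : F ≠ 0 := fun h => hn (by rw [← hF, h, natDegree_zero])
        have := leadingCoeff_ne_zero.mpr this
        rwa [leadingCoeff, hF] at this
      have hm : ((m + 1 : ℕ) : ℂ) ≠ 0 := Nat.cast_ne_zero.mpr hn
      have h1 : 1 + β / 2 ≠ 0 := fun h => by
        rw [← eq_neg_iff_add_eq_zero] at h
        have := congrArg norm h
        rw [norm_one, norm_neg] at this
        linarith
      have h2 : B.coeff (m + 1) = (m + 1 : ℕ) * (1 + β / 2) * F.coeff (m + 1) := by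
        rw [hB, coeff_add, coeff_C_mul, coeff_X_mul, coeff_derivative]
        push_cast
        ring
      rw [Nat.succ_eq_add_one, h2]
      exact mul_ne_zero (mul_ne_zero hm h1) hlead
  have hB0 : ∀ w : ℂ, 1 < ‖w‖ → B.eval w ≠ 0 := by
    intro w hw
    rw [hBeval]
    refine natDegree_mul_eval_add_mul_eval_derivative_ne_zero hn hF hF0 hw ?_
    have hw2 : 0 < ‖w‖ ^ 2 - 1 := by nlinarith
    have h1 : β / 2 * (‖w‖ ^ 2 - 1) + w * conj w =
        ((‖w‖ ^ 2 : ℝ) : ℂ) - -(β / 2 * ((‖w‖ ^ 2 - 1 : ℝ) : ℂ)) := by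
      rw [Complex.mul_conj']
      push_cast
      ring
    rw [h1]
    refine lt_of_lt_of_le ?_ (norm_sub_norm_le _ _)
    rw [norm_neg, norm_mul, Complex.norm_real, Complex.norm_real, Real.norm_of_nonneg hw2.le,
      Real.norm_of_nonneg (by positivity)]
    nlinarith [mul_le_mul_of_nonneg_right hβ2 hw2.le]
  have hS := natDegree_mul_eval_add_mul_eval_derivative_ne_zero hn hBdeg hB0
    (A := -a) (B := 1 + a * z) hz (by
      have h1 : -a * (‖z‖ ^ 2 - 1) + (1 + a * z) * conj z = conj z + a := by
        rw [← Complex.mul_conj']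
        ring
      rw [h1]
      refine lt_of_pow_lt_pow_left₀ 2 (norm_nonneg _) ?_
      have h3 := mul_pos (sub_pos.mpr (one_lt_pow₀ hz two_ne_zero))
        (sub_pos.mpr (pow_lt_one₀ (norm_nonneg a) ha two_ne_zero))
      rw [Complex.sq_norm, Complex.sq_norm, Complex.normSq_apply, Complex.normSq_apply] at h3 ⊢
      simp only [Complex.add_re, Complex.add_im, Complex.mul_re, Complex.mul_im, Complex.conj_re,
        Complex.conj_im, Complex.one_re, Complex.one_im]
      nlinarith [h3])
  rw [smirnovFunctional_apply]
  convert hS using 3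
  · rw [hBeval]
  · simp [hB, derivative_mul, add_assoc]

lemma two_mul_norm_smirnovFunctional_le {n : ℕ} (hn : n ≠ 0) {P : ℂ[X]} (hP : P.natDegree = n)
    (hP0 : ∀ w : ℂ, ‖w‖ < 1 → P.eval w ≠ 0) {a β z : ℂ} (ha : ‖a‖ ≤ 1) (hβ : ‖β‖ ≤ 1)
    (hz : 1 ≤ ‖z‖) :
    2 * ‖smirnovFunctional n a β z P‖ ≤
      (‖(n ^ 2 * (1 + β / 2) * z ^ (n - 1) : ℂ)‖ + ‖(-(n ^ 2 * a * β / 2) : ℂ)‖)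
        * maxCircle P := by
  let f : ℝ → ℝ := fun t => 2 * ‖smirnovFunctional n (t * a) β ((t : ℂ)⁻¹ * z) P‖
  let g : ℝ → ℝ := fun t => (‖(n ^ 2 * (1 + β / 2) * ((t : ℂ)⁻¹ * z) ^ (n - 1) : ℂ)‖
    + ‖(-(n ^ 2 * (t * a) * β / 2) : ℂ)‖) * maxCircle P
  have hinv : ContinuousAt (fun t : ℝ => (t : ℂ)⁻¹) 1 :=
    Complex.continuous_ofReal.continuousAt.inv₀ (by simp)
  have hf : ContinuousAt f 1 := by
    simp only [f, smirnovFunctional_apply]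
    have heval (Q : ℂ[X]) : ContinuousAt (fun t : ℝ => Q.eval ((t : ℂ)⁻¹ * z)) 1 :=
      Q.continuous.continuousAt.comp (hinv.mul continuousAt_const)
    have := heval P
    have := heval P.derivative
    have := heval P.derivative.derivative
    fun_prop
  have hg : ContinuousAt g 1 := by
    simp only [g]
    fun_prop
  have hfg : f 1 ≤ g 1 := by
    refine le_of_tendsto_of_tendsto (b := nhdsWithin (1 : ℝ) (Set.Iio 1))
      (hf.tendsto.mono_left nhdsWithin_le_nhds) (hg.tendsto.mono_left nhdsWithin_le_nhds) ?_
    filter_upwards [Ioo_mem_nhdsLT (zero_lt_one (α := ℝ))] with t ht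
    have hta : ‖(t * a : ℂ)‖ < 1 := by
      rw [norm_mul, Complex.norm_real, Real.norm_of_nonneg ht.1.le]
      nlinarith [ht.1, ht.2, norm_nonneg a]
    have htz : 1 < ‖((t : ℂ)⁻¹ * z)‖ := by
      rw [norm_mul, norm_inv, Complex.norm_real, Real.norm_of_nonneg ht.1.le]
      exact one_lt_mul_of_lt_of_le (one_lt_inv₀ ht.1 |>.mpr ht.2) hz
    have := two_mul_norm_functional_le (smirnovFunctional_ne_zero hn hta hβ htz) hP hP0
      fun w hw => norm_eval_le_maxCircle P hw
    rwa [smirnovFunctional_X_pow hn, smirnovFunctional_one] at this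
  simpa only [f, g, Complex.ofReal_one, one_mul, inv_one] using hfg

theorem statement7 (n : ℕ) (P : Polynomial ℂ) (hP : P.natDegree = n)
    (hP0 : ∀ w : ℂ, ‖w‖ < 1 → P.eval w ≠ 0)
    (a β : ℂ) (ha : ‖a‖ ≤ 1) (hβ : ‖β‖ ≤ 1)
    (z : ℂ) (hz : 1 ≤ ‖z‖) :
    ‖z * ((1 + a * z) * P.derivative.derivative.eval z
          - ((n - 1 : ℕ) : ℂ) * a * P.derivative.eval z)
        + ((n : ℂ) / 2) * β * ((1 + a * z) * P.derivative.eval z - (n : ℂ) * a * P.eval z)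
        + P.derivative.eval z‖
      ≤ ((n : ℝ) / 2) * (‖1 + β / 2‖ * ((n : ℝ) * ‖z‖ ^ (n - 1))
          + ((n : ℝ) / 2) * ‖β‖ * ‖a‖) * maxCircle P := by
  rcases eq_or_ne n 0 with rfl | hn
  · rw [eq_C_of_natDegree_eq_zero hP]
    simp
  have key := two_mul_norm_smirnovFunctional_le hn hP hP0 ha hβ hz
  have hn1 : ((n - 1 : ℕ) : ℂ) = n - 1 := by
    rw [Nat.cast_sub (Nat.one_le_iff_ne_zero.mpr hn), Nat.cast_one]
  have hexpr : smirnovFunctional n a β z P =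
      z * ((1 + a * z) * P.derivative.derivative.eval z
          - ((n - 1 : ℕ) : ℂ) * a * P.derivative.eval z)
        + ((n : ℂ) / 2) * β * ((1 + a * z) * P.derivative.eval z - (n : ℂ) * a * P.eval z)
        + P.derivative.eval z := by
    rw [smirnovFunctional_apply, hn1]
    ring
  rw [hexpr] at key
  simp only [norm_mul, norm_neg, norm_div, norm_pow, Complex.norm_natCast,
    Complex.norm_ofNat] at key
  linarith
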